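/- There is no projective 16-divisible binary linear code of effective length 131. That is, there is no linear subspace C of F₂^131 such that (i) for every coordinate i there is c ∈ C with c_i ≠ 0, (ii) for all distinct coordinates i ≠ j there is c ∈ C with c_i ≠ c_j, and (iii) 16 divides the Hamming weight of every codeword of C. -/

import Mathlib

/-- Hamming weight of a binary vector. -/
def hwt {n : ℕ} (c : Fin n → ZMod 2) : ℕ :=
  (Finset.univ.filter fun i => c i ≠ 0).card

namespace PDiv

open Finset

set_option linter.unusedSectionVars false

/-- the sign of a bit -/
def sg (a : ZMod 2) : ℤ := if a = 0 then 1 else -1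

lemma sg_add (a b : ZMod 2) : sg (a + b) = sg a * sg b := by
  revert a b; decide

lemma sg_ne {a : ZMod 2} (h : a ≠ 0) : sg a = -1 := by simp [sg, h]

/-- weight -/
def W {ι : Type} [Fintype ι] (c : ι → ZMod 2) : ℕ :=
  (Finset.univ.filter fun i => c i ≠ 0).card

/-- character sum of a word -/
def X {ι : Type} [Fintype ι] (c : ι → ZMod 2) : ℤ := ∑ i, sg (c i)

lemma W_eq_sum {ι : Type} [Fintype ι] (c : ι → ZMod 2) :
    W c = ∑ i, if c i ≠ 0 then 1 else 0 := by
  rw [W, Finset.card_filter]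

lemma X_eq {ι : Type} [Fintype ι] (c : ι → ZMod 2) :
    X c = (Fintype.card ι : ℤ) - 2 * (W c : ℤ) := by
  rw [W_eq_sum, X, ← Finset.card_univ, Finset.card_eq_sum_ones]
  push_cast
  rw [Finset.mul_sum, ← Finset.sum_sub_distrib]
  refine Finset.sum_congr rfl fun i _ => ?_
  by_cases h : c i = 0 <;> simp [sg, h]

lemma W_eq_zero {ι : Type} [Fintype ι] (c : ι → ZMod 2) : W c = 0 ↔ c = 0 := by
  constructor
  · intro h
    rw [W, Finset.card_eq_zero, Finset.filter_eq_empty_iff] at h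
    funext i
    simpa using h (Finset.mem_univ i)
  · rintro rfl
    simp [W]

/-- projective Δ-divisible code -/
structure PD {ι : Type} [Fintype ι] (Δ : ℕ) (C : Submodule (ZMod 2) (ι → ZMod 2)) : Prop where
  eff : ∀ i, ∃ c ∈ C, c i ≠ 0
  proj : ∀ i j, i ≠ j → ∃ c ∈ C, c i ≠ c j
  dvd : ∀ c ∈ C, Δ ∣ W c

/-- restriction to the zeros of c -/
def rho {ι : Type} (c : ι → ZMod 2) : (ι → ZMod 2) →ₗ[ZMod 2] ({i // c i = 0} → ZMod 2) :=
  LinearMap.funLeft (ZMod 2) (ZMod 2) Subtype.val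

lemma W_rho {ι : Type} [Fintype ι] (c d : ι → ZMod 2) :
    W (rho c d) = ∑ i, if c i = 0 ∧ d i ≠ 0 then 1 else 0 := by
  have h1 : W (rho c d) = ∑ i : {i // c i = 0}, if d i ≠ 0 then 1 else 0 := by
    rw [W_eq_sum]; rfl
  rw [h1, ← Finset.sum_subtype (p := fun i => c i = 0) (univ.filter fun i => c i = 0) (by simp)
    (fun i => if d i ≠ 0 then 1 else 0)]
  rw [Finset.sum_filter]
  · refine Finset.sum_congr rfl fun i _ => ?_
    by_cases h : c i = 0 <;> simp [h]

lemma W_add {ι : Type} [Fintype ι] (c d : ι → ZMod 2) :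
    2 * W (rho c d) + W c = W d + W (c + d) := by
  rw [W_rho, W_eq_sum c, W_eq_sum d, W_eq_sum (c + d), Finset.mul_sum, ← Finset.sum_add_distrib,
    ← Finset.sum_add_distrib]
  refine Finset.sum_congr rfl fun i _ => ?_
  rw [Pi.add_apply]
  generalize c i = a
  generalize d i = b
  revert a b; decide

lemma W_rho_le {ι : Type} [Fintype ι] (c d : ι → ZMod 2) : W (rho c d) ≤ W d := by
  rw [W_rho, W_eq_sum d]
  refine Finset.sum_le_sum fun i _ => ?_
  generalize c i = a
  generalize d i = b
  revert a b; decide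

lemma card_zero {ι : Type} [Fintype ι] (c : ι → ZMod 2) :
    Fintype.card {i // c i = 0} + W c = Fintype.card ι := by
  rw [Fintype.card_subtype, W, Finset.card_filter_add_card_filter_not, Finset.card_univ]

lemma PD.res {ι : Type} [Fintype ι] {Δ : ℕ} {C : Submodule (ZMod 2) (ι → ZMod 2)}
    (h : PD (2 * Δ) C) {c : ι → ZMod 2} (hc : c ∈ C) : PD Δ (C.map (rho c)) := by
  refine ⟨?_, ?_, ?_⟩
  · rintro ⟨i, hi⟩
    obtain ⟨d, hd, hdi⟩ := h.eff i
    exact ⟨rho c d, Submodule.mem_map_of_mem hd, hdi⟩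
  · rintro ⟨i, hi⟩ ⟨j, hj⟩ hij
    obtain ⟨d, hd, hdi⟩ := h.proj i j (fun e => hij (Subtype.ext e))
    exact ⟨rho c d, Submodule.mem_map_of_mem hd, hdi⟩
  · rintro _ ⟨d, hd, rfl⟩
    have h1 := h.dvd c hc
    have h2 := h.dvd d hd
    have h3 := h.dvd _ (C.add_mem hc hd)
    have h4 := W_add c d
    have h5 : 2 * Δ ∣ 2 * W (rho c d) + W c := h4 ▸ dvd_add h2 h3
    exact Nat.dvd_of_mul_dvd_mul_left two_pos ((Nat.dvd_add_left h1).1 h5)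

section moments

variable {ι : Type} [Fintype ι] {C : Submodule (ZMod 2) (ι → ZMod 2)} [Fintype C]

lemma charsum (f : C → ZMod 2) (hf : ∀ a b, f (a + b) = f a + f b) (h : ∃ c, f c ≠ 0) :
    ∑ c, sg (f c) = 0 := by
  obtain ⟨c0, h0⟩ := h
  have h1 : ∑ c, sg (f (c + c0)) = ∑ c, sg (f c) :=
    Equiv.sum_comp (Equiv.addRight c0) (fun c => sg (f c))
  have h2 : ∑ c, sg (f (c + c0)) = - ∑ c, sg (f c) := by
    rw [← Finset.sum_neg_distrib]
    refine Finset.sum_congr rfl fun c _ => ?_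
    rw [hf, sg_add, sg_ne h0]; ring
  linarith

lemma charsum_nonneg (f : C → ZMod 2) (hf : ∀ a b, f (a + b) = f a + f b) :
    0 ≤ ∑ c, sg (f c) := by
  by_cases h : ∃ c, f c ≠ 0
  · rw [charsum f hf h]
  · push Not at h
    exact Finset.sum_nonneg fun c _ => by simp [h c, sg]

lemma cs1 {Δ : ℕ} (h : PD Δ C) (i : ι) : ∑ c : C, sg (c.1 i) = 0 := by
  obtain ⟨c, hc, hi⟩ := h.eff i
  exact charsum (fun c : C => c.1 i) (fun a b => rfl) ⟨⟨c, hc⟩, hi⟩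

lemma cs2 {Δ : ℕ} (h : PD Δ C) [DecidableEq ι] (i j : ι) :
    ∑ c : C, sg (c.1 i) * sg (c.1 j) = if i = j then (Fintype.card C : ℤ) else 0 := by
  simp_rw [← sg_add]
  split_ifs with hij
  · subst hij
    have : ∀ a : ZMod 2, sg (a + a) = 1 := by decide
    simp [this]
  · obtain ⟨c, hc, hi⟩ := h.proj i j hij
    refine charsum (fun c : C => c.1 i + c.1 j) (fun a b => ?_) ⟨⟨c, hc⟩, ?_⟩
    · simp only [Submodule.coe_add, Pi.add_apply]; ring
    · revert hi
      simp only
      generalize c i = a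
      generalize c j = b
      revert a b; decide

lemma M1 {Δ : ℕ} (h : PD Δ C) : ∑ c : C, X c.1 = 0 := by
  unfold X
  rw [Finset.sum_comm]
  exact Finset.sum_eq_zero fun i _ => cs1 h i

lemma Mi {Δ : ℕ} (h : PD Δ C) (i : ι) : ∑ c : C, X c.1 * sg (c.1 i) = Fintype.card C := by
  classical
  unfold X
  simp_rw [Finset.sum_mul]
  rw [Finset.sum_comm]
  simp_rw [cs2 h]
  simp

lemma M2 {Δ : ℕ} (h : PD Δ C) : ∑ c : C, X c.1 ^ 2 = Fintype.card ι * Fintype.card C := by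
  have : ∀ c : C, X c.1 ^ 2 = ∑ i, X c.1 * sg (c.1 i) := by
    intro c
    rw [← Finset.mul_sum, sq]; rfl
  simp_rw [this]
  rw [Finset.sum_comm]
  simp_rw [Mi h]
  simp

lemma M3 : 0 ≤ ∑ c : C, X c.1 ^ 3 := by
  have : ∀ c : C, X c.1 ^ 3 = ∑ i, ∑ j, ∑ k, sg (c.1 i + c.1 j + c.1 k) := by
    intro c
    simp_rw [sg_add, ← Finset.mul_sum, ← Finset.sum_mul, ← Finset.mul_sum, ← Finset.sum_mul]
    unfold X
    ring
  simp_rw [this]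
  rw [Finset.sum_comm]
  refine Finset.sum_nonneg fun i _ => ?_
  rw [Finset.sum_comm]
  refine Finset.sum_nonneg fun j _ => ?_
  rw [Finset.sum_comm]
  refine Finset.sum_nonneg fun k _ => ?_
  refine charsum_nonneg (fun c : C => c.1 i + c.1 j + c.1 k) fun a b => ?_
  simp only [Submodule.coe_add, Pi.add_apply]; ring

lemma card_pow : ∃ k, Fintype.card C = 2 ^ k := by
  refine ⟨Module.finrank (ZMod 2) C, ?_⟩
  rw [Module.card_eq_pow_finrank (K := ZMod 2) (V := C), ZMod.card]

/-- number of words of a given weight -/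
def A (C : Submodule (ZMod 2) (ι → ZMod 2)) [Fintype C] (w : ℕ) : ℤ :=
  ∑ c : C, if W c.1 = w then 1 else 0

lemma A_eq_card (w : ℕ) : A C w = ((univ.filter fun c : C => W c.1 = w).card : ℤ) := by
  unfold A; rw [Finset.card_filter]; push_cast; rfl

lemma A_nonneg (w : ℕ) : 0 ≤ A C w := by rw [A_eq_card]; positivity

lemma A_zero : A C 0 = 1 := by
  rw [A_eq_card]
  have : (univ.filter fun c : C => W c.1 = 0) = {0} := by
    ext c; simp [W_eq_zero]
  simp [this]

lemma A_pos {c : ι → ZMod 2} (hc : c ∈ C) : 0 < A C (W c) := by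
  rw [A_eq_card]
  have : (⟨c, hc⟩ : C) ∈ (univ.filter fun d : C => W d.1 = W c) := by simp
  exact_mod_cast Finset.card_pos.2 ⟨_, this⟩

lemma exists_of_A {w : ℕ} (h : A C w ≠ 0) : ∃ c ∈ C, W c = w := by
  by_contra hn
  push Not at hn
  apply h
  unfold A
  exact Finset.sum_eq_zero fun c _ => by simp [hn c.1 c.2]

end moments

/-- nonexistence of short codes -/
lemma short {ι : Type} [Fintype ι] (Δ m : ℕ) (C : Submodule (ZMod 2) (ι → ZMod 2))
    (h : PD Δ C) (hΔ : 0 < Δ) (hn : Fintype.card ι = 2 * Δ * m + 3) (hlt : 2 * Δ * m + 3 < 6 * Δ - 9) :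
    False := by
  classical
  have : Fintype C := Fintype.ofFinite C
  have h1 := M1 h
  have h2 := M2 h
  have h0 : 0 ≤ ∑ c : C, (X c.1 - 3) * (X c.1 + (2 * Δ - 3)) := by
    refine Finset.sum_nonneg fun c _ => ?_
    obtain ⟨t, ht⟩ := h.dvd c.1 c.2
    have hx : X c.1 - 3 = 2 * Δ * ((m : ℤ) - t) := by
      rw [X_eq, hn, ht]; push_cast; ring
    have hx2 : X c.1 + (2 * Δ - 3) = 2 * Δ * ((m : ℤ) - t + 1) := by
      linear_combination hx
    rw [hx, hx2]
    have : 0 ≤ ((m : ℤ) - t) * ((m : ℤ) - t + 1) := by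
      rcases le_or_gt 0 ((m : ℤ) - t) with h | h
      · positivity
      · exact mul_nonneg_of_nonpos_of_nonpos (by omega) (by omega)
    have h4 : (0 : ℤ) ≤ (2 * Δ) ^ 2 := by positivity
    nlinarith [mul_nonneg h4 this]
  have he : ∑ c : C, (X c.1 - 3) * (X c.1 + (2 * Δ - 3)) =
      ∑ c : C, X c.1 ^ 2 + (2 * Δ - 6) * ∑ c : C, X c.1 - 3 * (2 * Δ - 3) * Fintype.card C := by
    have : ∀ c : C, (X c.1 - 3) * (X c.1 + (2 * Δ - 3)) =
      X c.1 ^ 2 + (2 * Δ - 6) * X c.1 - 3 * (2 * Δ - 3) := fun c => by ring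
    simp_rw [this]
    rw [Finset.sum_sub_distrib, Finset.sum_add_distrib, ← Finset.mul_sum]
    simp [mul_comm]
  rw [he, h1, h2, hn] at h0
  have hc : (0 : ℤ) < Fintype.card C := by exact_mod_cast Fintype.card_pos
  have hlt' : (2 * Δ * m + 3 : ℤ) < 6 * Δ - 9 := by
    have : 2 * Δ * m + 3 + 9 < 6 * Δ := by omega
    zify at this
    linarith
  push_cast at h0
  nlinarith

lemma c51 {ι : Type} [Fintype ι] (C : Submodule (ZMod 2) (ι → ZMod 2)) [Fintype C]
    (h : PD 8 C) (hn : Fintype.card ι = 51) :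
    Fintype.card C = 256 ∧ ∀ c ∈ C, W c = 0 ∨ W c = 24 ∨ W c = 32 := by
  classical
  have hw : ∀ c ∈ C, W c = 0 ∨ W c = 8 ∨ W c = 16 ∨ W c = 24 ∨ W c = 32 := by
    intro c hc
    have hz := card_zero c
    have hr : PD 4 (C.map (rho c)) := PD.res (Δ := 4) h hc
    obtain ⟨t, ht⟩ := h.dvd c hc
    have h5 : W c ≠ 40 := fun e => short 4 1 _ hr (by norm_num) (by omega) (by norm_num)
    have h6 : W c ≠ 48 := fun e => short 4 0 _ hr (by norm_num) (by omega) (by norm_num)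
    omega
  have h1 := M1 h
  have h2 := M2 h
  have h3 := M3 (C := C)
  rw [hn] at h2
  have e1 : ∑ c : C, (X c.1 ^ 2 + 10 * X c.1 - 39) = 3072 * A C 0 + 1536 * A C 8 + 512 * A C 16 := by
    unfold A
    simp_rw [Finset.mul_sum, ← Finset.sum_add_distrib]
    refine Finset.sum_congr rfl fun c _ => ?_
    rw [X_eq, hn]
    rcases hw c.1 c.2 with h | h | h | h | h <;> rw [h] <;> norm_num
  have e2 : ∑ c : C, (X c.1 ^ 3 + 10 * X c.1 ^ 2 - 39 * X c.1) =
      51 * 3072 * A C 0 + 35 * 1536 * A C 8 + 19 * 512 * A C 16 := by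
    unfold A
    simp_rw [Finset.mul_sum, ← Finset.sum_add_distrib]
    refine Finset.sum_congr rfl fun c _ => ?_
    rw [X_eq, hn]
    rcases hw c.1 c.2 with h | h | h | h | h <;> rw [h] <;> norm_num
  rw [Finset.sum_sub_distrib, Finset.sum_add_distrib, ← Finset.mul_sum, h1, h2] at e1
  rw [Finset.sum_sub_distrib, Finset.sum_add_distrib, ← Finset.mul_sum, ← Finset.mul_sum,
    h1, h2] at e2
  have a8 := A_nonneg (C := C) 8
  have a16 := A_nonneg (C := C) 16
  rw [A_zero] at e1 e2
  simp only [Finset.sum_const, Finset.card_univ, smul_eq_mul, nsmul_eq_mul] at e1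
  obtain ⟨k, hk⟩ := card_pow (C := C)
  have hlo : 256 ≤ Fintype.card C := by
    zify
    push_cast at e1
    linarith
  have hhi : Fintype.card C < 1024 := by
    zify
    push_cast at e1 e2
    linarith
  have hk8 : 8 ≤ k := by
    by_contra hlt
    have : 2 ^ k ≤ 2 ^ 7 := Nat.pow_le_pow_right (by norm_num) (by omega)
    omega
  have hk9 : k < 10 := by
    by_contra hlt
    have : 2 ^ 10 ≤ 2 ^ k := Nat.pow_le_pow_right (by norm_num) (by omega)
    omega
  obtain rfl | rfl : k = 8 ∨ k = 9 := by omega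
  · rw [hk] at e1
    refine ⟨by rw [hk]; norm_num, fun c hc => ?_⟩
    have hp := A_pos hc
    norm_num at e1
    rcases hw c hc with h | h | h | h | h
    · exact Or.inl h
    · rw [h] at hp; omega
    · rw [h] at hp; omega
    · exact Or.inr (Or.inl h)
    · exact Or.inr (Or.inr h)
  · exfalso
    rw [hk] at e1 e2
    norm_num at e1 e2
    have h8 : A C 8 = 2 := by omega
    have h16 : A C 16 = 0 := by omega
    rw [A_eq_card] at h8
    have h8' : (univ.filter fun c : C => W c.1 = 8).card = 2 := by exact_mod_cast h8
    obtain ⟨a, b, hab, hs⟩ := Finset.card_eq_two.1 h8'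
    have ha : W a.1 = 8 := by
      have : a ∈ univ.filter fun c : C => W c.1 = 8 := by rw [hs]; simp
      simpa using this
    have hb : W b.1 = 8 := by
      have : b ∈ univ.filter fun c : C => W c.1 = 8 := by rw [hs]; simp
      simpa using this
    have hadd := W_add a.1 b.1
    have hle := W_rho_le a.1 b.1
    have hm := C.add_mem a.2 b.2
    have hp := A_pos hm
    have hne0 : W (a.1 + b.1) ≠ 0 := by
      rw [Ne, W_eq_zero]
      intro h0
      apply hab
      apply Subtype.ext
      funext i
      have := congrFun h0 i
      revert this
      simp only [Pi.add_apply, Pi.zero_apply]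
      generalize a.1 i = u
      generalize b.1 i = v
      revert u v; decide
    rcases hw _ hm with h | h | h | h | h
    · exact hne0 h
    · have : (⟨a.1 + b.1, hm⟩ : C) ∈ univ.filter fun c : C => W c.1 = 8 := by simp [h]
      rw [hs] at this
      simp only [Finset.mem_insert, Finset.mem_singleton] at this
      have e : (⟨a.1 + b.1, hm⟩ : C) = a + b := rfl
      rw [e] at this
      rcases this with h | h
      · have : b = 0 := by simpa using h
        subst this
        simp [W] at hb
      · have : a = 0 := by simpa using h
        subst this
        simp [W] at ha
    · rw [h] at hp; omega
    · omega
    · omega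

lemma main (C : Submodule (ZMod 2) (Fin 131 → ZMod 2)) (h : PD 16 C) : False := by
  classical
  have : Fintype C := Fintype.ofFinite C
  have hn : Fintype.card (Fin 131) = 131 := by simp
  have hw : ∀ c ∈ C, W c = 0 ∨ W c = 16 ∨ W c = 32 ∨ W c = 48 ∨ W c = 64 ∨ W c = 80 := by
    intro c hc
    have hz := card_zero c
    have hr : PD 8 (C.map (rho c)) := PD.res (Δ := 8) h hc
    obtain ⟨t, ht⟩ := h.dvd c hc
    have h5 : W c ≠ 96 := fun e => short 8 2 _ hr (by norm_num) (by omega) (by norm_num)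
    have h6 : W c ≠ 112 := fun e => short 8 1 _ hr (by norm_num) (by omega) (by norm_num)
    have h7 : W c ≠ 128 := fun e => short 8 0 _ hr (by norm_num) (by omega) (by norm_num)
    omega
  have h1 := M1 h
  have h2 := M2 h
  rw [hn] at h2
  have e1 : ∑ c : C, (X c.1 ^ 2 + 26 * X c.1 - 87) = 20480 * A C 0 + 12288 * A C 16
      + 6144 * A C 32 + 2048 * A C 48 := by
    unfold A
    simp_rw [Finset.mul_sum, ← Finset.sum_add_distrib]
    refine Finset.sum_congr rfl fun c _ => ?_
    rw [X_eq, hn]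
    rcases hw c.1 c.2 with h | h | h | h | h | h <;> rw [h] <;> norm_num
  have e2 : ∑ c : C, (X c.1 - 3) = 128 * A C 0 + 96 * A C 16 + 64 * A C 32 + 32 * A C 48
      + (-32) * A C 80 := by
    unfold A
    simp_rw [Finset.mul_sum, ← Finset.sum_add_distrib]
    refine Finset.sum_congr rfl fun c _ => ?_
    rw [X_eq, hn]
    rcases hw c.1 c.2 with h | h | h | h | h | h <;> rw [h] <;> norm_num
  rw [Finset.sum_sub_distrib, Finset.sum_add_distrib, ← Finset.mul_sum, h1, h2] at e1
  rw [Finset.sum_sub_distrib, h1] at e2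
  have a16 := A_nonneg (C := C) 16
  have a32 := A_nonneg (C := C) 32
  have a48 := A_nonneg (C := C) 48
  rw [A_zero] at e1 e2
  simp only [Finset.sum_const, Finset.card_univ, smul_eq_mul, nsmul_eq_mul] at e1 e2
  push_cast at e1
  have hres : ∀ c ∈ C, W c = 80 → (Nat.card (C.map (rho c)) = 256 ∧
      ∀ d ∈ C, W (rho c d) = 0 ∨ W (rho c d) = 24 ∨ W (rho c d) = 32) := by
    intro c hc h80
    have hz := card_zero c
    have hr : PD 8 (C.map (rho c)) := PD.res (Δ := 8) h hc
    have : Fintype (C.map (rho c)) := Fintype.ofFinite _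
    obtain ⟨ha, hb⟩ := c51 _ hr (by omega)
    exact ⟨by rw [Nat.card_eq_fintype_card, ha], fun d hd => hb _ (Submodule.mem_map_of_mem hd)⟩
  obtain ⟨k, hk⟩ := card_pow (C := C)
  have hlo : 464 ≤ Fintype.card C := by
    zify
    linarith
  have hk9 : 9 ≤ k := by
    by_contra hlt
    have : 2 ^ k ≤ 2 ^ 8 := Nat.pow_le_pow_right (by norm_num) (by omega)
    omega
  obtain rfl | hk10 : k = 9 ∨ 10 ≤ k := by omega
  · rw [hk] at e1 e2
    norm_num at e1 e2
    have b16 : A C 16 = 0 := by omega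
    have b32 : A C 32 = 0 := by omega
    have b48 : A C 48 = 1 := by omega
    have b80 : A C 80 = 53 := by omega
    obtain ⟨e, he, hwe⟩ := exists_of_A (C := C) (w := 48) (by omega)
    rw [A_eq_card] at b80
    have b80' : (univ.filter fun c : C => W c.1 = 80).card = 53 := by exact_mod_cast b80
    have hz : ∑ c ∈ univ.filter (fun c : C => W c.1 = 80), (1 : ZMod 2) = 0 := by
      refine Finset.sum_involution (fun c _ => c + ⟨e, he⟩) ?_ ?_ ?_ ?_
      · intros; decide
      · intro c hc _ hce
        have : (⟨e, he⟩ : C) = 0 := by simpa using hce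
        have : e = 0 := congrArg Subtype.val this
        rw [this] at hwe
        simp [W] at hwe
      · intro c hc
        have hc' : W c.1 = 80 := by simpa using hc
        have hadd := W_add c.1 e
        have hm := C.add_mem c.2 he
        have hp := A_pos hm
        have : W (c.1 + e) = 80 := by
          rcases (hres c.1 c.2 hc').2 e he with h | h | h
          · have : W (c.1 + e) = 32 := by omega
            rw [this] at hp; omega
          · omega
          · have := hw _ hm
            omega
        simpa using this
      · intro c hc
        apply Subtype.ext
        funext i
        show c.1 i + e i + e i = c.1 i
        generalize c.1 i = u
        generalize e i = v
        revert u v; decide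
    rw [Finset.sum_const, b80'] at hz
    revert hz; decide
  · have hy : 1024 ≤ Fintype.card C := by
      rw [hk]
      exact Nat.pow_le_pow_right (n := 2) (by norm_num) hk10
    have b80 : A C 80 ≠ 0 := by
      intro h0
      have : (1024 : ℤ) ≤ Fintype.card C := by exact_mod_cast hy
      rw [h0] at e2
      linarith
    obtain ⟨c0, hc0, hw0⟩ := exists_of_A b80
    obtain ⟨e, he, he1, hel⟩ : ∃ e ∈ C, W e ≠ 0 ∧ W e ≤ 32 := by
      by_contra hno
      push Not at hno
      -- every word in the kernel is 0 or c0
      have hker : ∀ d ∈ C, rho c0 d = 0 → d = 0 ∨ d = c0 := by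
        intro d hd h0
        have hadd := W_add c0 d
        rw [h0] at hadd
        have hz0 : W (0 : {i // c0 i = 0} → ZMod 2) = 0 := (W_eq_zero _).2 rfl
        rw [hz0] at hadd
        have hm := C.add_mem hc0 hd
        by_cases g1 : W d = 0
        · exact Or.inl ((W_eq_zero _).1 g1)
        by_cases g2 : W (c0 + d) = 0
        · right
          have := (W_eq_zero _).1 g2
          funext i
          have := congrFun this i
          revert this
          simp only [Pi.add_apply, Pi.zero_apply]
          generalize c0 i = u
          generalize d i = v
          revert u v; decide
        have k1 := hno d hd g1
        have k2 := hno _ hm g2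
        have k3 := hw d hd
        have k4 := hw _ hm
        omega
      let f : C → C.map (rho c0) := fun d => ⟨rho c0 d.1, Submodule.mem_map_of_mem d.2⟩
      have : Fintype (C.map (rho c0)) := Fintype.ofFinite _
      have hcard : Fintype.card (C.map (rho c0)) = 256 := by
        rw [← Nat.card_eq_fintype_card]; exact (hres c0 hc0 hw0).1
      obtain ⟨y, hy2⟩ := Fintype.exists_lt_card_fiber_of_mul_lt_card (f := f) (n := 2)
        (by rw [hcard]; omega)
      obtain ⟨a, b, c, ha, hb, hc, hab, hac, hbc⟩ := Finset.two_lt_card_iff.1 hy2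
      simp only [Finset.mem_filter, Finset.mem_univ, true_and] at ha hb hc
      have key : ∀ u v : C, f u = y → f v = y → u ≠ v → v = u + ⟨c0, hc0⟩ := by
        intro u v hu hv huv
        have h0 : rho c0 (v - u : C).1 = 0 := by
          have : rho c0 u.1 = rho c0 v.1 := congrArg Subtype.val (hu.trans hv.symm)
          rw [Submodule.coe_sub, map_sub, this, sub_self]
        rcases hker _ (v - u : C).2 h0 with h | h
        · exact absurd (sub_eq_zero.1 (Subtype.ext h : v - u = 0)).symm huv
        · have : v - u = ⟨c0, hc0⟩ := Subtype.ext h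
          rw [← this]; abel
      exact hbc ((key a b ha hb hab).trans (key a c ha hc hac).symm)
    have hsub : ∀ c ∈ C, W c = 80 → ∀ i, e i ≠ 0 → c i ≠ 0 := by
      intro c hc h80 i hi hci
      have hadd := W_add c e
      have hle := W_rho_le c e
      have hm := hw _ (C.add_mem hc he)
      have h0 : W (rho c e) = 0 := by
        rcases (hres c hc h80).2 e he with h | h | h
        · exact h
        · omega
        · omega
      have := congrFun ((W_eq_zero _).1 h0) ⟨i, hci⟩
      exact hi this
    obtain ⟨i, hi⟩ : ∃ i, e i ≠ 0 := by
      by_contra hno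
      push Not at hno
      exact he1 ((W_eq_zero _).2 (funext hno))
    have m := Mi h i
    have m1 := cs1 h i
    have hnn : 0 ≤ ∑ c : C, (X c.1 - 3) * (1 + sg (c.1 i)) := by
      refine Finset.sum_nonneg fun c _ => ?_
      by_cases hci : c.1 i = 0
      · have : W c.1 ≠ 80 := fun h80 => hsub c.1 c.2 h80 i hi hci
        have hx : 0 ≤ X c.1 - 3 := by
          rw [X_eq, hn]
          have := hw c.1 c.2
          push_cast
          omega
        simp only [sg, hci, if_true]
        linarith
      · simp [sg, hci]
    have : ∀ c : C, (X c.1 - 3) * (1 + sg (c.1 i)) =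
        X c.1 + X c.1 * sg (c.1 i) - 3 * sg (c.1 i) - 3 := fun c => by ring
    simp_rw [this] at hnn
    rw [Finset.sum_sub_distrib, Finset.sum_sub_distrib, Finset.sum_add_distrib, ← Finset.mul_sum,
      m, m1, h1] at hnn
    simp only [Finset.sum_const, Finset.card_univ, nsmul_eq_mul] at hnn
    omega

end PDiv

theorem no_projective_16_divisible_131 :
    ¬ ∃ C : Submodule (ZMod 2) (Fin 131 → ZMod 2),
      (∀ i : Fin 131, ∃ c ∈ C, c i ≠ 0) ∧
      (∀ i j : Fin 131, i ≠ j → ∃ c ∈ C, c i ≠ c j) ∧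
      (∀ c ∈ C, 16 ∣ hwt c) := by
  rintro ⟨C, h1, h2, h3⟩
  exact PDiv.main C ⟨h1, h2, h3⟩
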